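/- arXiv:1806.04980 — 3 statements merged into one kernel-verified Lean document; each statement's English description precedes it below -/
import Mathlib

section
/- Let K be a number field, let N ≥ 1 and d ≥ 2, and let f : P^N → P^N be a morphism of degree d defined over K. Then the set PrePer(f, P^N(K)) = {P ∈ P^N(K) : f^n(P) = f^m(P) for some n > m ≥ 0} of K-rational preperiodic points of f is finite. -/
open MvPolynomial
open scoped LinearAlgebra.Projectivization

namespace MvPolynomial

section Graded

attribute [local instance] MvPolynomial.gradedAlgebra

theorem homogeneousComponent_add_mul {σ R : Type*} [CommSemiring R] {d : ℕ}
    (g : MvPolynomial σ R) {p : MvPolynomial σ R} (hp : p.IsHomogeneous d) (m : ℕ) :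
    homogeneousComponent (m + d) (g * p) = homogeneousComponent m g * p := by
  have h := DirectSum.coe_decompose_mul_add_of_right_mem (homogeneousSubmodule σ R)
    (i := m) (a := g) ((mem_homogeneousSubmodule d p).mpr hp)
  simp only [← decomposition.decompose'_apply]
  exact h

end Graded

/-- **Projective Nullstellensatz.** Homogeneous polynomials of degree `d` over `k` without a common
nontrivial zero over an algebraically closed extension generate an ideal containing some power of
every variable, and the coefficients may be taken homogeneous. -/
theorem exists_isHomogeneous_sum_mul_eq_X_pow {k L σ ι : Type*} [Field k] [Field L] [IsAlgClosed L]
    [Algebra k L] [Fintype σ] [Fintype ι] {d : ℕ} {p : ι → MvPolynomial σ k}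
    (hp : ∀ i, (p i).IsHomogeneous d)
    (hzero : ∀ v : σ → L, (∀ i, aeval v (p i) = 0) → v = 0) :
    ∃ (m : ℕ) (q : σ × ι → MvPolynomial σ k), (∀ a, (q a).IsHomogeneous m) ∧
      ∀ j, ∑ i, q (j, i) * p i = X j ^ (m + d) := by
  have hrad (j : σ) : (X j : MvPolynomial σ k) ∈ (Ideal.span (Set.range p)).radical := by
    rw [← vanishingIdeal_zeroLocus_eq_radical (K := L), mem_vanishingIdeal_iff]
    intro v hv
    rw [hzero v fun i ↦ hv _ (Ideal.subset_span ⟨i, rfl⟩)]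
    simp
  choose e he using hrad
  have hmem (j : σ) : (X j : MvPolynomial σ k) ^ (∑ i, e i + d) ∈ Ideal.span (Set.range p) :=
    Ideal.pow_mem_of_pow_mem _ (he j)
      ((Finset.single_le_sum (fun _ _ ↦ Nat.zero_le _) (Finset.mem_univ j)).trans
        (Nat.le_add_right _ _))
  choose g hg using fun j ↦ Ideal.mem_span_range_iff_exists_fun.mp (hmem j)
  refine ⟨∑ i, e i, fun a ↦ homogeneousComponent (∑ i, e i) (g a.1 a.2),
    fun a ↦ homogeneousComponent_isHomogeneous _ _, fun j ↦ ?_⟩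
  rw [← homogeneousComponent_eq_self (isHomogeneous_X_pow j (∑ i, e i + d)), ← hg j, map_sum]
  exact Finset.sum_congr rfl fun i _ ↦ (homogeneousComponent_add_mul _ (hp i) _).symm

end MvPolynomial

/-- Over a field with the Northcott property, projective space has finitely many points of bounded
logarithmic height. -/
theorem Projectivization.northcott_logHeight {K ι : Type*} [Field K] [Height.AdmissibleAbsValues K]
    [Northcott (Height.logHeight₁ (K := K))] [Finite ι] :
    Northcott (Projectivization.logHeight (K := K) (ι := ι)) where
  finite_le B := by
    have hfin : {w : ι → K | ∀ i, Height.logHeight₁ (w i) ≤ B}.Finite :=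
      Set.Finite.pi' fun _ : ι ↦ Northcott.finite_le (h := Height.logHeight₁ (K := K)) B
    have hex (P : ℙ K (ι → K)) (hP : P.logHeight ≤ B) :
        ∃ w ∈ {w : ι → K | ∀ i, Height.logHeight₁ (w i) ≤ B}, ∃ hw : w ≠ 0, mk K w hw = P := by
      induction P with | h v hv =>
      rw [logHeight_mk] at hP
      obtain ⟨j, hj⟩ := Function.ne_iff.mp hv
      rw [Pi.zero_apply] at hj
      refine ⟨(v j)⁻¹ • v, fun i ↦ ?_, smul_ne_zero (inv_ne_zero hj) hv, ?_⟩
      · rw [Pi.smul_apply, smul_eq_mul, inv_mul_eq_div, Height.logHeight₁_div_eq_logHeight]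
        refine le_trans ?_ hP
        have hcomp : ![v i, v j] = v ∘ ![i, j] := by
          ext a
          fin_cases a <;> rfl
        exact hcomp ▸ Height.logHeight_comp_le ![i, j] v
      · rw [mk_eq_mk_iff']
        exact ⟨(v j)⁻¹, rfl⟩
    classical
    refine (hfin.image fun w ↦ if hw : w ≠ 0 then some (mk K w hw) else none).preimage
      (Option.some_injective _).injOn |>.subset fun P hP ↦ ?_
    obtain ⟨w, hwB, hw, rfl⟩ := hex P hP
    exact ⟨w, hwB, dif_pos hw⟩

/-- A function that strictly increases along a self-map wherever it exceeds `B` is at most `B` at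
every preperiodic point. -/
theorem le_of_iterate_eq_iterate {α : Type*} {F : α → α} {h : α → ℝ} {B : ℝ} {P : α}
    (hF : ∀ x, B < h x → h x < h (F x)) {m n : ℕ} (hmn : m < n) (hP : F^[n] P = F^[m] P) :
    h P ≤ B := by
  by_contra! hB
  have hlt (k : ℕ) : B < h (F^[k] P) := by
    induction k with
    | zero => exact hB
    | succ k ih => exact ih.trans (by simpa only [Function.iterate_succ_apply'] using hF _ ih)
  have hmono : StrictMono fun k ↦ h (F^[k] P) :=
    strictMono_nat_of_lt_succ fun k ↦ by
      simpa only [Function.iterate_succ_apply'] using hF _ (hlt k)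
  exact (hmono hmn).ne' (congrArg h hP)

/-- Northcott: let K be a number field, N ≥ 1, d ≥ 2, and let
f : P^N → P^N be a morphism of degree d defined over K, i.e. f is induced by
homogeneous polynomials f_0, …, f_N of degree d with coefficients in K having no common
nontrivial zero over an algebraic closure of K. Then the set of K-rational preperiodic
points of f in P^N(K) is finite. -/
theorem northcott_preperiodic_finite
    (K : Type*) [Field K] [NumberField K] (N d : ℕ) (hN : 1 ≤ N) (hd : 2 ≤ d)
    (f : Fin (N + 1) → MvPolynomial (Fin (N + 1)) K)
    (hdeg : ∀ i, (f i).IsHomogeneous d)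
    (hmor : ∀ v : Fin (N + 1) → AlgebraicClosure K,
      (∀ i, eval v (MvPolynomial.map (algebraMap K (AlgebraicClosure K)) (f i)) = 0) → v = 0)
    (hK : ∀ v : Fin (N + 1) → K, v ≠ 0 → (fun i => eval v (f i)) ≠ 0)
    (F : ℙ K (Fin (N + 1) → K) → ℙ K (Fin (N + 1) → K))
    (hF : ∀ (v : Fin (N + 1) → K) (hv : v ≠ 0),
      F (Projectivization.mk K v hv) =
        Projectivization.mk K (fun i => eval v (f i)) (hK v hv)) :
    {P : ℙ K (Fin (N + 1) → K) | ∃ n m : ℕ, m < n ∧ F^[n] P = F^[m] P}.Finite := by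
  have hzero (v : Fin (N + 1) → AlgebraicClosure K) (hv : ∀ i, aeval v (f i) = 0) : v = 0 :=
    hmor v fun i ↦ by rw [eval_map, ← aeval_def, hv i]
  obtain ⟨m, q, hq, hqf⟩ := exists_isHomogeneous_sum_mul_eq_X_pow hdeg hzero
  obtain ⟨C, hC⟩ := Height.logHeight_eval_ge' (N := d) hq
  have hgrow (P : ℙ K (Fin (N + 1) → K)) : C + d * P.logHeight ≤ (F P).logHeight := by
    induction P with | h v hv =>
    rw [hF v hv, Projectivization.logHeight_mk, Projectivization.logHeight_mk]
    exact hC f fun k ↦ by simpa using congrArg (eval v) (hqf k)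
  have hd' : (2 : ℝ) ≤ d := mod_cast hd
  have hincr (P : ℙ K (Fin (N + 1) → K)) (hP : -C < P.logHeight) :
      P.logHeight < (F P).logHeight := by
    nlinarith [hgrow P, P.logHeight_nonneg]
  refine (Projectivization.northcott_logHeight.finite_le (-C)).subset ?_
  rintro P ⟨n, m, hmn, hP⟩
  exact le_of_iterate_eq_iterate hincr hmn hP
end

section
/- For each N ∈ {1, 2, 3}, there are infinitely many c ∈ ℚ such that the polynomial f_c(x) = x² + c has a periodic point α ∈ ℚ of exact period N. -/
/-- For positive `t`, the starting point `(t³ + 2t² + t + 1) / (2t(t+1))` has exact period three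
under `x² + c`, for `c` the usual parametrisation of maps with a rational 3-cycle. -/
theorem exists_exact_period_three (t : ℚ) (ht : 0 < t) :
    ∃ α : ℚ, (fun x : ℚ => x ^ 2 +
        -(t ^ 6 + 2 * t ^ 5 + 4 * t ^ 4 + 8 * t ^ 3 + 9 * t ^ 2 + 4 * t + 1) /
          (4 * t ^ 2 * (t + 1) ^ 2))^[3] α = α ∧
      ∀ i : ℕ, 1 ≤ i → i < 3 → (fun x : ℚ => x ^ 2 +
        -(t ^ 6 + 2 * t ^ 5 + 4 * t ^ 4 + 8 * t ^ 3 + 9 * t ^ 2 + 4 * t + 1) /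
          (4 * t ^ 2 * (t + 1) ^ 2))^[i] α ≠ α := by
  set f : ℚ → ℚ := fun x : ℚ => x ^ 2 +
    -(t ^ 6 + 2 * t ^ 5 + 4 * t ^ 4 + 8 * t ^ 3 + 9 * t ^ 2 + 4 * t + 1) /
      (4 * t ^ 2 * (t + 1) ^ 2) with hf
  have h1 : f ((t ^ 3 + 2 * t ^ 2 + t + 1) / (2 * t * (t + 1))) =
      (t ^ 3 - t - 1) / (2 * t * (t + 1)) := by
    simp only [hf]
    field_simp
    ring
  have h2 : f ((t ^ 3 - t - 1) / (2 * t * (t + 1))) =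
      -(t ^ 3 + 2 * t ^ 2 + 3 * t + 1) / (2 * t * (t + 1)) := by
    simp only [hf]
    field_simp
    ring
  have h3 : f (-(t ^ 3 + 2 * t ^ 2 + 3 * t + 1) / (2 * t * (t + 1))) =
      (t ^ 3 + 2 * t ^ 2 + t + 1) / (2 * t * (t + 1)) := by
    simp only [hf]
    field_simp
    ring
  have hd : 0 < 2 * t * (t + 1) := by positivity
  refine ⟨(t ^ 3 + 2 * t ^ 2 + t + 1) / (2 * t * (t + 1)), ?_, ?_⟩
  · simp only [Function.iterate_succ_apply, Function.iterate_zero_apply, h1, h2, h3]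
  · intro i hi hi'
    interval_cases i
    · rw [Function.iterate_one, h1]
      refine ne_of_lt ((div_lt_div_iff_of_pos_right hd).2 ?_)
      nlinarith [sq_nonneg t]
    · rw [Function.iterate_succ_apply, Function.iterate_one, h1, h2]
      refine ne_of_lt ((div_lt_div_iff_of_pos_right hd).2 ?_)
      nlinarith [sq_nonneg t, pow_pos ht 3]

/-- For each N ∈ {1, 2, 3}, there are infinitely many c ∈ ℚ such that the
polynomial f_c(x) = x² + c has a periodic point α ∈ ℚ of exact period N. -/
theorem infinitely_many_c_with_exact_period (N : ℕ) (hN : N ∈ ({1, 2, 3} : Set ℕ)) :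
    {c : ℚ | ∃ α : ℚ, (fun x : ℚ => x ^ 2 + c)^[N] α = α ∧
      ∀ i : ℕ, 1 ≤ i → i < N → (fun x : ℚ => x ^ 2 + c)^[i] α ≠ α}.Infinite := by
  refine Set.infinite_of_forall_exists_lt fun a => ?_
  obtain ⟨m, hm, hma⟩ : ∃ m : ℚ, 0 < m ∧ -m < a :=
    ⟨|a| + 1, by positivity, by linarith [neg_abs_le a]⟩
  rcases hN with rfl | rfl | rfl
  · refine ⟨(m + 1) - (m + 1) ^ 2, ⟨m + 1, ?_, fun i hi hi' => by omega⟩, ?_⟩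
    · simp
    · nlinarith
  · refine ⟨-1 - m - m ^ 2, ⟨m, ?_, fun i hi hi' => ?_⟩, ?_⟩
    · simp only [Function.iterate_succ_apply, Function.iterate_zero_apply]
      ring
    · obtain rfl : i = 1 := by omega
      rw [Function.iterate_one]
      intro h
      linarith
    · nlinarith
  · have ht : 0 < 4 * m + 4 := by positivity
    refine ⟨_, exists_exact_period_three (4 * m + 4) ht, lt_of_le_of_lt ?_ hma⟩
    rw [div_le_iff₀ (by positivity), ← sub_nonneg]
    ring_nf
    positivity
end

section
/- Let d ≥ 1 and n ≥ 1. Work in the polynomial ring ℤ[a_0,…,a_d, b_0,…,b_d, X, Y] where a_0,…,a_d, b_0,…,b_d are indeterminate coefficients, and set F(X,Y) = a_0 X^d + a_1 X^{d−1}Y + ⋯ + a_d Y^d and G(X,Y) = b_0 X^d + b_1 X^{d−1}Y + ⋯ + b_d Y^d. Define the iterates F_1 = F, G_1 = G, and F_{n+1}(X,Y) = F(F_n(X,Y), G_n(X,Y)), G_{n+1}(X,Y) = G(F_n(X,Y), G_n(X,Y)). Then the product ∏_{m ∣ n, μ(n/m) = −1} (Y·F_m(X,Y) − X·G_m(X,Y))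 divides the product ∏_{m ∣ n, μ(n/m) = 1} (Y·F_m(X,Y) − X·G_m(X,Y)) in the ring ℤ[a_0,…,a_d, b_0,…,b_d, X, Y]; that is, the n-th dynatomic polynomial Φ_n(X,Y) = ∏_{m ∣ n} (Y·F_m − X·G_m)^{μ(n/m)} is a polynomial with integer coefficients. -/
open MvPolynomial

/-- The ring ℤ[a_0, …, a_d, b_0, …, b_d] of generic coefficients. -/
abbrev CoeffRing (d : ℕ) := MvPolynomial (Fin (d + 1) ⊕ Fin (d + 1)) ℤ

/-- The generic homogeneous polynomial F(X, Y) = a_0 X^d + a_1 X^{d-1} Y + ⋯ + a_d Y^d. -/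
noncomputable def genF (d : ℕ) : MvPolynomial (Fin 2) (CoeffRing d) :=
  ∑ i : Fin (d + 1), C (X (Sum.inl i)) * X 0 ^ (d - (i : ℕ)) * X 1 ^ (i : ℕ)

/-- The generic homogeneous polynomial G(X, Y) = b_0 X^d + b_1 X^{d-1} Y + ⋯ + b_d Y^d. -/
noncomputable def genG (d : ℕ) : MvPolynomial (Fin 2) (CoeffRing d) :=
  ∑ i : Fin (d + 1), C (X (Sum.inr i)) * X 0 ^ (d - (i : ℕ)) * X 1 ^ (i : ℕ)

/-- The iterated pair (F_n, G_n): F_0 = X, G_0 = Y, F_{n+1} = F(F_n, G_n),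
G_{n+1} = G(F_n, G_n). -/
noncomputable def genIter (d : ℕ) :
    ℕ → MvPolynomial (Fin 2) (CoeffRing d) × MvPolynomial (Fin 2) (CoeffRing d)
  | 0 => (X 0, X 1)
  | k + 1 =>
      (aeval ![(genIter d k).1, (genIter d k).2] (genF d),
       aeval ![(genIter d k).1, (genIter d k).2] (genG d))

theorem sum_moebius_div_filter_dvd_nonneg (n r : ℕ) :
    0 ≤ ∑ m ∈ n.divisors with r ∣ m, ArithmeticFunction.moebius (n / m) := by
  by_cases hrn : n ≠ 0 ∧ r ∣ n
  · obtain ⟨hn, k, rfl⟩ := hrn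
    have hr : 0 < r := Nat.pos_of_ne_zero (left_ne_zero_of_mul hn)
    have hk : k ≠ 0 := right_ne_zero_of_mul hn
    have hset : {m ∈ (r * k).divisors | r ∣ m} = k.divisors.image (r * ·) := by
      ext m
      simp only [Finset.mem_filter, Nat.mem_divisors, Finset.mem_image]
      constructor
      · rintro ⟨⟨hm, -⟩, j, rfl⟩
        exact ⟨j, ⟨Nat.dvd_of_mul_dvd_mul_left hr hm, hk⟩, rfl⟩
      · rintro ⟨j, ⟨hj, -⟩, rfl⟩
        exact ⟨⟨Nat.mul_dvd_mul_left r hj, hn⟩, Nat.dvd_mul_right r j⟩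
    rw [hset, Finset.sum_image fun _ _ _ _ h => Nat.eq_of_mul_eq_mul_left hr h]
    simp_rw [Nat.mul_div_mul_left _ _ hr]
    rw [Nat.sum_div_divisors k fun m => ArithmeticFunction.moebius m,
      ← ArithmeticFunction.coe_mul_zeta_apply, ArithmeticFunction.moebius_mul_coe_zeta,
      ArithmeticFunction.one_apply]
    split_ifs <;> norm_num
  · refine (Finset.sum_eq_zero fun m hm => ?_).ge
    obtain ⟨hm, hrm⟩ := Finset.mem_filter.1 hm
    exact absurd ⟨(Nat.mem_divisors.1 hm).2, hrm.trans (Nat.dvd_of_mem_divisors hm)⟩ hrn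

theorem exists_forall_iff_dvd_of_gcd {H : ℕ → Prop}
    (hH : ∀ m k, H (m.gcd k) ↔ H m ∧ H k) : ∃ r, ∀ m, m ≠ 0 → (H m ↔ r ∣ m) := by
  classical
  by_cases hex : ∃ r, r ≠ 0 ∧ H r
  · obtain ⟨hr, hHr⟩ := Nat.find_spec hex
    refine ⟨Nat.find hex, fun m hm => ⟨fun h => ?_, fun h => ?_⟩⟩
    · have hle := Nat.find_min' hex ⟨Nat.gcd_ne_zero_right hm, (hH _ m).2 ⟨hHr, h⟩⟩
      exact Nat.gcd_eq_left_iff_dvd.1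
        (le_antisymm (Nat.gcd_le_left _ (Nat.pos_of_ne_zero hr)) hle)
    · exact ((hH _ m).1 (by rwa [Nat.gcd_eq_left h])).2
  · push Not at hex
    exact ⟨0, fun m hm => ⟨fun h => absurd h (hex m hm), fun h => absurd (zero_dvd_iff.1 h) hm⟩⟩

theorem card_filter_moebius_le (n : ℕ) {H : ℕ → Prop} [DecidablePred H]
    (hH : ∀ m k, H (m.gcd k) ↔ H m ∧ H k) :
    (∑ m ∈ n.divisors with ArithmeticFunction.moebius (n / m) = -1, if H m then 1 else 0) ≤
      ∑ m ∈ n.divisors with ArithmeticFunction.moebius (n / m) = 1, if H m then 1 else 0 := by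
  obtain ⟨r, hr⟩ := exists_forall_iff_dvd_of_gcd hH
  have key := sum_moebius_div_filter_dvd_nonneg n r
  zify
  rw [← sub_nonneg]
  refine key.trans_eq ?_
  simp only [Finset.sum_filter]
  rw [← Finset.sum_sub_distrib]
  refine Finset.sum_congr rfl fun m hm => ?_
  simp only [hr m (Nat.pos_of_mem_divisors hm).ne']
  have hle := ArithmeticFunction.abs_moebius_le_one (n := n / m)
  rw [abs_le] at hle
  generalize ArithmeticFunction.moebius (n / m) = c at hle ⊢
  obtain ⟨h₁, h₂⟩ := hle
  interval_cases c <;> by_cases hrm : r ∣ m <;> simp [hrm]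

theorem multiplicity_eq_sum_ite {R : Type*} [CommMonoidWithZero R] {p x : R}
    [DecidablePred fun e => p ^ e ∣ x] (h : FiniteMultiplicity p x) {N : ℕ}
    (hN : multiplicity p x ≤ N) :
    multiplicity p x = ∑ e ∈ Finset.range N, if p ^ (e + 1) ∣ x then 1 else 0 := by
  have hset : {e ∈ Finset.range N | p ^ (e + 1) ∣ x} = Finset.range (multiplicity p x) := by
    ext e
    rw [Finset.mem_filter, Finset.mem_range, Finset.mem_range, h.pow_dvd_iff_le_multiplicity]
    omega
  rw [Finset.sum_boole, hset, Finset.card_range, Nat.cast_id]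

/-- The Möbius product of a sequence satisfying the strong divisibility property at all prime
powers is integral. -/
theorem prod_moebius_dvd_prod_of_strong_divisibility {R : Type*} [CommRing R] [IsDomain R]
    [UniqueFactorizationMonoid R] {ψ : ℕ → R} (hψ : ∀ m, m ≠ 0 → ψ m ≠ 0)
    (hgcd : ∀ p : R, Prime p → ∀ e m k, p ^ e ∣ ψ (m.gcd k) ↔ p ^ e ∣ ψ m ∧ p ^ e ∣ ψ k) (n : ℕ) :
    (∏ m ∈ n.divisors with ArithmeticFunction.moebius (n / m) = -1, ψ m) ∣
      ∏ m ∈ n.divisors with ArithmeticFunction.moebius (n / m) = 1, ψ m := by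
  classical
  have hne : ∀ m ∈ n.divisors, ψ m ≠ 0 := fun m hm => hψ m (Nat.pos_of_mem_divisors hm).ne'
  rw [UniqueFactorizationMonoid.dvd_iff_emultiplicity_le
    (Finset.prod_ne_zero_iff.2 fun m hm => hne m (Finset.mem_filter.1 hm).1)]
  intro p hp
  have hfin : ∀ m ∈ n.divisors, FiniteMultiplicity p (ψ m) :=
    fun m hm => .of_prime_left hp (hne m hm)
  set N := ∑ m ∈ n.divisors, multiplicity p (ψ m) with hN
  have hsum : ∀ c : ℤ,
      emultiplicity p (∏ m ∈ n.divisors with ArithmeticFunction.moebius (n / m) = c, ψ m) =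
      ((∑ e ∈ Finset.range N, ∑ m ∈ n.divisors with ArithmeticFunction.moebius (n / m) = c,
        if p ^ (e + 1) ∣ ψ m then 1 else 0 : ℕ) : ℕ∞) := by
    intro c
    rw [Finset.emultiplicity_prod hp, Finset.sum_comm, Nat.cast_sum]
    refine Finset.sum_congr rfl fun m hm => ?_
    have hm := (Finset.mem_filter.1 hm).1
    rw [(hfin m hm).emultiplicity_eq_multiplicity, ← multiplicity_eq_sum_ite (hfin m hm)]
    exact Finset.single_le_sum (f := fun m => multiplicity p (ψ m)) (fun _ _ => Nat.zero_le _) hm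
  rw [hsum, hsum, Nat.cast_le]
  exact Finset.sum_le_sum fun e _ => card_filter_moebius_le n (hgcd p hp (e + 1))

theorem gcd_iff_of_add {H : ℕ → Prop} (h_zero : H 0) (h_add : ∀ m k, H m → (H (m + k) ↔ H k))
    (m k : ℕ) : H (m.gcd k) ↔ H m ∧ H k := by
  have h_mul : ∀ m, H m → ∀ j, H (m * j) := fun m hm j => by
    induction j with
    | zero => exact h_zero
    | succ j ih => rw [Nat.mul_succ]; exact (h_add _ _ ih).2 hm
  have h_dvd : ∀ m k, m ∣ k → H m → H k := by
    rintro m _ ⟨j, rfl⟩ hm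
    exact h_mul m hm j
  refine ⟨fun h => ⟨h_dvd _ _ (Nat.gcd_dvd_left m k) h, h_dvd _ _ (Nat.gcd_dvd_right m k) h⟩, ?_⟩
  rintro ⟨hm, hk⟩
  induction m, k using Nat.gcd.induction with
  | H0 k => rwa [Nat.gcd_zero_left]
  | H1 m k _ ih =>
    rw [Nat.gcd_rec]
    refine ih ?_ hm
    rwa [← h_add (m * (k / m)) (k % m) (h_mul m hm _), Nat.div_add_mod]

section LocalDivisibility

variable {R : Type*} [CommRing R]

theorem sub_dvd_sum_mul_sum_sub (d : ℕ) (a b : Fin (d + 1) → R) (u v w z : R) :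
    (u * z - v * w) ∣
      (∑ i : Fin (d + 1), a i * u ^ (d - (i : ℕ)) * v ^ (i : ℕ)) *
        (∑ i : Fin (d + 1), b i * w ^ (d - (i : ℕ)) * z ^ (i : ℕ)) -
      (∑ i : Fin (d + 1), b i * u ^ (d - (i : ℕ)) * v ^ (i : ℕ)) *
        (∑ i : Fin (d + 1), a i * w ^ (d - (i : ℕ)) * z ^ (i : ℕ)) := by
  have key : ∀ i j : ℕ, i ≤ j → j ≤ d →
      (u * z - v * w) ∣ u ^ (d - i) * v ^ i * (w ^ (d - j) * z ^ j) -
        u ^ (d - j) * v ^ j * (w ^ (d - i) * z ^ i) := by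
    intro i j hij hj
    obtain ⟨k, rfl⟩ := Nat.exists_eq_add_of_le hij
    obtain ⟨l, rfl⟩ := Nat.exists_eq_add_of_le hj
    have h₁ : i + k + l - i = k + l := by omega
    have h₂ : i + k + l - (i + k) = l := by omega
    rw [h₁, h₂]
    refine ((sub_dvd_pow_sub_pow (u * z) (v * w) k).mul_left
      (u ^ l * v ^ i * w ^ l * z ^ i)).trans (dvd_of_eq ?_)
    ring
  rw [Finset.sum_mul_sum, Finset.sum_mul_sum, Finset.sum_comm (s := Finset.univ),
    ← Finset.sum_sub_distrib]
  refine Finset.dvd_sum fun j _ => ?_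
  rw [← Finset.sum_sub_distrib]
  refine Finset.dvd_sum fun i _ => ?_
  have hij : (u * z - v * w) ∣
      u ^ (d - (i : ℕ)) * v ^ (i : ℕ) * (w ^ (d - (j : ℕ)) * z ^ (j : ℕ)) -
        u ^ (d - (j : ℕ)) * v ^ (j : ℕ) * (w ^ (d - (i : ℕ)) * z ^ (i : ℕ)) := by
    rcases le_total (i : ℕ) j with h | h
    · exact key i j h j.is_le
    · rw [← dvd_neg, neg_sub]
      exact key j i h i.is_le
  refine (hij.mul_left (a i * b j)).trans (dvd_of_eq ?_)
  ring

theorem pow_dvd_cross_trans [IsDomain R] {p : R} (hp : Prime p) {e : ℕ} {u v s t w z : R}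
    (hst : ¬ (p ∣ s ∧ p ∣ t)) (h₁ : p ^ e ∣ u * t - v * s) (h₂ : p ^ e ∣ s * z - t * w) :
    p ^ e ∣ u * z - v * w := by
  have hs : p ^ e ∣ s * (u * z - v * w) := by
    refine ((h₁.mul_left w).add (h₂.mul_left u)).trans (dvd_of_eq ?_)
    ring
  have ht : p ^ e ∣ t * (u * z - v * w) := by
    refine ((h₁.mul_left z).add (h₂.mul_left v)).trans (dvd_of_eq ?_)
    ring
  by_cases h : p ∣ s
  · exact hp.pow_dvd_of_dvd_mul_left e (fun h' => hst ⟨h, h'⟩) ht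
  · exact hp.pow_dvd_of_dvd_mul_left e h hs

end LocalDivisibility

theorem genIter_succ_fst (d k : ℕ) : (genIter d (k + 1)).1 =
    ∑ i : Fin (d + 1), C (X (Sum.inl i)) * (genIter d k).1 ^ (d - (i : ℕ)) *
      (genIter d k).2 ^ (i : ℕ) := by
  simp [genIter, genF]

theorem genIter_succ_snd (d k : ℕ) : (genIter d (k + 1)).2 =
    ∑ i : Fin (d + 1), C (X (Sum.inr i)) * (genIter d k).1 ^ (d - (i : ℕ)) *
      (genIter d k).2 ^ (i : ℕ) := by
  simp [genIter, genG]

theorem pow_dvd_cross_genIter_add {d e : ℕ} {p : MvPolynomial (Fin 2) (CoeffRing d)} {m n : ℕ}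
    (h : p ^ e ∣ (genIter d m).1 * (genIter d n).2 - (genIter d m).2 * (genIter d n).1) (k : ℕ) :
    p ^ e ∣ (genIter d (m + k)).1 * (genIter d (n + k)).2 -
      (genIter d (m + k)).2 * (genIter d (n + k)).1 := by
  induction k with
  | zero => exact h
  | succ k ih =>
    rw [← add_assoc, ← add_assoc, genIter_succ_fst, genIter_succ_snd, genIter_succ_fst,
      genIter_succ_snd]
    exact ih.trans (sub_dvd_sum_mul_sum_sub d _ _ _ _ _ _)

/-- Specialization of the generic ring at given coefficients and a given point. -/
noncomputable def specialize {d : ℕ} {S : Type*} [CommRing S] (a b : Fin (d + 1) → S) (x y : S) :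
    MvPolynomial (Fin 2) (CoeffRing d) →+* S :=
  eval₂Hom (eval₂Hom (Int.castRingHom S) (Sum.elim a b)) ![x, y]

section Specialize

variable {d : ℕ} {S : Type*} [CommRing S] (a b : Fin (d + 1) → S) (x y : S)

@[simp] theorem specialize_inl (i : Fin (d + 1)) :
    specialize a b x y (C (X (Sum.inl i))) = a i := by simp [specialize]

@[simp] theorem specialize_inr (i : Fin (d + 1)) :
    specialize a b x y (C (X (Sum.inr i))) = b i := by simp [specialize]

@[simp] theorem specialize_X_zero : specialize a b x y (X 0) = x := by simp [specialize]

@[simp] theorem specialize_X_one : specialize a b x y (X 1) = y := by simp [specialize]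

theorem genericRing_hom_ext {f g : MvPolynomial (Fin 2) (CoeffRing d) →+* S}
    (hl : ∀ i, f (C (X (Sum.inl i))) = g (C (X (Sum.inl i))))
    (hr : ∀ i, f (C (X (Sum.inr i))) = g (C (X (Sum.inr i))))
    (h₀ : f (X 0) = g (X 0)) (h₁ : f (X 1) = g (X 1)) : f = g := by
  refine MvPolynomial.ringHom_ext' (MvPolynomial.ringHom_ext' (Subsingleton.elim _ _) ?_) ?_
  · rintro (i | i)
    · exact hl i
    · exact hr i
  · intro i
    fin_cases i
    · exact h₀
    · exact h₁

end Specialize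

theorem map_genIter_succ {d : ℕ} {S : Type*} [Semiring S]
    (f : MvPolynomial (Fin 2) (CoeffRing d) →+* S) (k : ℕ) :
    f (genIter d (k + 1)).1 = ∑ i : Fin (d + 1), f (C (X (Sum.inl i))) *
      f (genIter d k).1 ^ (d - (i : ℕ)) * f (genIter d k).2 ^ (i : ℕ) ∧
    f (genIter d (k + 1)).2 = ∑ i : Fin (d + 1), f (C (X (Sum.inr i))) *
      f (genIter d k).1 ^ (d - (i : ℕ)) * f (genIter d k).2 ^ (i : ℕ) := by
  rw [genIter_succ_fst, genIter_succ_snd]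
  simp only [map_sum, map_mul, map_pow, and_self]

theorem cross_genIter_ne_zero (d : ℕ) {m : ℕ} (hm : m ≠ 0) :
    X 1 * (genIter d m).1 - X 0 * (genIter d m).2 ≠ 0 := by
  let f : MvPolynomial (Fin 2) (CoeffRing d) →+* ℤ :=
    specialize (fun i => if i = 0 then 1 else 0) (fun _ => 0) 1 1
  have hf : ∀ k, f (genIter d k).1 = 1 ∧ f (genIter d (k + 1)).2 = 0 := by
    intro k
    induction k with
    | zero =>
      refine ⟨by simp [f, genIter], ?_⟩
      rw [(map_genIter_succ f 0).2]
      simp [f]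
    | succ k ih =>
      refine ⟨?_, by simp [map_genIter_succ, f]⟩
      rw [(map_genIter_succ f k).1, ih.1]
      simp [f, ite_mul]
  obtain ⟨k, rfl⟩ := Nat.exists_eq_succ_of_ne_zero hm
  intro h
  have h' := congrArg f h
  rw [map_sub, map_mul, map_mul, (hf (k + 1)).1, (hf k).2] at h'
  simp [f] at h'

theorem eq_C_mul_X_pow_of_dvd {R : Type*} [CommRing R] [IsDomain R] {q : Polynomial R} {c : R}
    {N : ℕ} (hc : c ≠ 0) (h : q ∣ Polynomial.C c * Polynomial.X ^ N) :
    ∃ (r : R) (j : ℕ), q = Polynomial.C r * Polynomial.X ^ j := by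
  obtain ⟨s, hs⟩ := h
  have hne : q * s ≠ 0 :=
    hs ▸ mul_ne_zero (Polynomial.C_ne_zero.2 hc) (pow_ne_zero _ Polynomial.X_ne_zero)
  have hq : q ≠ 0 := left_ne_zero_of_mul hne
  have hs' : s ≠ 0 := right_ne_zero_of_mul hne
  have h₁ : q.natDegree + s.natDegree = N := by
    rw [← Polynomial.natDegree_mul hq hs', ← hs, Polynomial.natDegree_C_mul_X_pow N c hc]
  have h₂ : q.natTrailingDegree + s.natTrailingDegree = N := by
    rw [← Polynomial.natTrailingDegree_mul hq hs', ← hs, Polynomial.C_mul_X_pow_eq_monomial,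
      Polynomial.natTrailingDegree_monomial hc]
  have h₃ := q.natTrailingDegree_le_natDegree
  have h₄ := s.natTrailingDegree_le_natDegree
  refine ⟨q.coeff q.natDegree, q.natDegree, ?_⟩
  ext i
  rw [Polynomial.coeff_C_mul_X_pow]
  split_ifs with hi
  · rw [hi]
  · rcases lt_or_gt_of_ne hi with hi | hi
    · exact Polynomial.coeff_eq_zero_of_lt_natTrailingDegree (by omega)
    · exact Polynomial.coeff_eq_zero_of_natDegree_lt hi

/-- The homomorphism scaling all generic coefficients by a new variable. -/
noncomputable def scaleCoeff (d : ℕ) : MvPolynomial (Fin 2) (CoeffRing d) →+*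
    Polynomial (MvPolynomial (Fin 2) (CoeffRing d)) :=
  specialize (S := Polynomial (MvPolynomial (Fin 2) (CoeffRing d)))
    (fun i => Polynomial.C (C (X (Sum.inl i))) * Polynomial.X)
    (fun i => Polynomial.C (C (X (Sum.inr i))) * Polynomial.X)
    (Polynomial.C (X 0)) (Polynomial.C (X 1))

theorem exists_scaleCoeff_genIter (d m : ℕ) : ∃ N : ℕ,
    scaleCoeff d (genIter d m).1 = Polynomial.C (genIter d m).1 * Polynomial.X ^ N ∧
    scaleCoeff d (genIter d m).2 = Polynomial.C (genIter d m).2 * Polynomial.X ^ N := by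
  induction m with
  | zero => exact ⟨0, by simp [scaleCoeff, genIter], by simp [scaleCoeff, genIter]⟩
  | succ m ih =>
    obtain ⟨N, h₁, h₂⟩ := ih
    have hpow : ∀ i : Fin (d + 1), (Polynomial.X : Polynomial (MvPolynomial (Fin 2) (CoeffRing d)))
        ^ (N * d + 1) = Polynomial.X * ((Polynomial.X ^ N) ^ (d - (i : ℕ)) *
          (Polynomial.X ^ N) ^ (i : ℕ)) := fun i => by
      rw [← pow_add, Nat.sub_add_cancel i.is_le, pow_succ', pow_mul]
    refine ⟨N * d + 1, ?_, ?_⟩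
    · rw [(map_genIter_succ (scaleCoeff d) m).1, genIter_succ_fst, h₁, h₂, map_sum,
        Finset.sum_mul]
      refine Finset.sum_congr rfl fun i _ => ?_
      rw [hpow i]
      simp only [scaleCoeff, specialize_inl, map_mul, map_pow, mul_pow]
      ring
    · rw [(map_genIter_succ (scaleCoeff d) m).2, genIter_succ_snd, h₁, h₂, map_sum,
        Finset.sum_mul]
      refine Finset.sum_congr rfl fun i _ => ?_
      rw [hpow i]
      simp only [scaleCoeff, specialize_inr, map_mul, map_pow, mul_pow]
      ring

/-- Specialization to the diagonal map `[s X ^ d, t Y ^ d]`, with `s, t, X, Y` the variables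
of the target. -/
noncomputable def toDiagonal (d : ℕ) :
    MvPolynomial (Fin 2) (CoeffRing d) →+* MvPolynomial (Fin 4) ℤ :=
  specialize (fun i => if i = 0 then X 0 else 0) (fun i => if i = Fin.last d then X 1 else 0)
    (X 2) (X 3)

theorem exists_toDiagonal_genIter (d m : ℕ) : ∃ N D N' D' : ℕ,
    toDiagonal d (genIter d m).1 = X 0 ^ N * X 2 ^ D ∧
    toDiagonal d (genIter d m).2 = X 1 ^ N' * X 3 ^ D' := by
  induction m with
  | zero => exact ⟨0, 1, 0, 1, by simp [toDiagonal, genIter], by simp [toDiagonal, genIter]⟩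
  | succ m ih =>
    obtain ⟨N, D, N', D', h₁, h₂⟩ := ih
    refine ⟨N * d + 1, D * d, N' * d + 1, D' * d, ?_, ?_⟩
    · rw [(map_genIter_succ _ m).1, h₁, h₂]
      simp only [toDiagonal, specialize_inl, ite_mul, zero_mul]
      simp
      ring
    · rw [(map_genIter_succ _ m).2, h₁, h₂]
      simp only [toDiagonal, specialize_inr, ite_mul, zero_mul]
      simp
      ring

theorem isRelPrime_X_X {σ R : Type*} [CommRing R] [IsDomain R] {i j : σ} (hij : i ≠ j) :
    IsRelPrime (X i : MvPolynomial σ R) (X j) :=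
  (X_prime.irreducible.isRelPrime_iff_not_dvd).2 fun h => hij (X_dvd_X.1 h)

/-- The homomorphism scaling the coefficients of a diagonal map by a new variable. -/
noncomputable def scaleDiagonal : MvPolynomial (Fin 4) ℤ →+* Polynomial (MvPolynomial (Fin 4) ℤ) :=
  eval₂Hom (Int.castRingHom _) ![Polynomial.C (X 0) * Polynomial.X,
    Polynomial.C (X 1) * Polynomial.X, Polynomial.C (X 2), Polynomial.C (X 3)]

/-- The homomorphism sending the coefficients of a diagonal map to zero. -/
noncomputable def ofDiagonal (d : ℕ) :
    MvPolynomial (Fin 4) ℤ →+* MvPolynomial (Fin 2) (CoeffRing d) :=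
  eval₂Hom (Int.castRingHom _) ![0, 0, X 0, X 1]

theorem map_toDiagonal_comp_scaleCoeff (d : ℕ) :
    (Polynomial.mapRingHom (toDiagonal d)).comp (scaleCoeff d) =
      scaleDiagonal.comp (toDiagonal d) := by
  apply genericRing_hom_ext
  · intro i
    simp only [RingHom.comp_apply, scaleCoeff, toDiagonal, specialize_inl]
    split_ifs with hi <;> simp [hi, scaleDiagonal]
  · intro i
    simp only [RingHom.comp_apply, scaleCoeff, toDiagonal, specialize_inr]
    split_ifs with hi <;> simp [hi, scaleDiagonal]
  · simp [scaleCoeff, toDiagonal, scaleDiagonal]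
  · simp [scaleCoeff, toDiagonal, scaleDiagonal]

theorem eval_one_comp_scaleCoeff (d : ℕ) :
    (Polynomial.evalRingHom 1).comp (scaleCoeff d) = RingHom.id _ := by
  apply genericRing_hom_ext <;> simp [scaleCoeff]

theorem eval_zero_comp_scaleCoeff (d : ℕ) :
    (Polynomial.evalRingHom 0).comp (scaleCoeff d) = (ofDiagonal d).comp (toDiagonal d) := by
  apply genericRing_hom_ext
  · intro i
    simp only [RingHom.comp_apply, scaleCoeff, toDiagonal, specialize_inl]
    split_ifs with hi <;> simp [ofDiagonal]
  · intro i
    simp only [RingHom.comp_apply, scaleCoeff, toDiagonal, specialize_inr]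
    split_ifs with hi <;> simp [ofDiagonal]
  · simp [scaleCoeff, toDiagonal, ofDiagonal]
  · simp [scaleCoeff, toDiagonal, ofDiagonal]

theorem isRelPrime_toDiagonal_genIter (d m : ℕ) :
    IsRelPrime (toDiagonal d (genIter d m).1) (toDiagonal d (genIter d m).2) := by
  obtain ⟨N, D, N', D', h₁, h₂⟩ := exists_toDiagonal_genIter d m
  have hpow : ∀ {i j : Fin 4} (a b : ℕ), i ≠ j →
      IsRelPrime (X i ^ a : MvPolynomial (Fin 4) ℤ) (X j ^ b) :=
    fun _ _ hij => (isRelPrime_X_X hij).pow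
  rw [h₁, h₂]
  exact ((hpow N N' (by decide)).mul_right (hpow N D' (by decide))).mul_left
    ((hpow D N' (by decide)).mul_right (hpow D D' (by decide)))

theorem toDiagonal_genIter_fst_ne_zero (d m : ℕ) : toDiagonal d (genIter d m).1 ≠ 0 := by
  obtain ⟨N, D, -, -, h₁, -⟩ := exists_toDiagonal_genIter d m
  rw [h₁]
  exact mul_ne_zero (pow_ne_zero N (X_ne_zero 0)) (pow_ne_zero D (X_ne_zero 2))

/-- An element homogeneous in the coefficients is a unit as soon as its diagonal specialization
is. -/
theorem isUnit_of_isUnit_toDiagonal {d j : ℕ} {p r : MvPolynomial (Fin 2) (CoeffRing d)}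
    (hr : scaleCoeff d p = Polynomial.C r * Polynomial.X ^ j) (hunit : IsUnit (toDiagonal d p)) :
    IsUnit p := by
  have hj : j = 0 := by
    have hu : IsUnit (Polynomial.mapRingHom (toDiagonal d) (scaleCoeff d p)) := by
      rw [← RingHom.comp_apply, map_toDiagonal_comp_scaleCoeff, RingHom.comp_apply]
      exact hunit.map scaleDiagonal
    rw [hr, map_mul, map_pow, Polynomial.coe_mapRingHom, Polynomial.map_X] at hu
    by_contra hj
    exact Polynomial.not_isUnit_X ((isUnit_pow_iff hj).1 (isUnit_of_mul_isUnit_right hu))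
  have hp : p = ofDiagonal d (toDiagonal d p) := by
    have h₁ := RingHom.congr_fun (eval_one_comp_scaleCoeff d) p
    have h₀ := RingHom.congr_fun (eval_zero_comp_scaleCoeff d) p
    rw [RingHom.comp_apply, hr, hj, pow_zero, mul_one, Polynomial.coe_evalRingHom,
      Polynomial.eval_C] at h₁ h₀
    rw [← RingHom.comp_apply, ← h₀, h₁, RingHom.id_apply]
  rw [hp]
  exact hunit.map (ofDiagonal d)

theorem isRelPrime_genIter (d m : ℕ) : IsRelPrime (genIter d m).1 (genIter d m).2 := by
  intro p hp₁ hp₂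
  obtain ⟨N, hs, -⟩ := exists_scaleCoeff_genIter d m
  have hne : (genIter d m).1 ≠ 0 := fun h =>
    toDiagonal_genIter_fst_ne_zero d m (by rw [h, map_zero])
  have hdvd : scaleCoeff d p ∣ Polynomial.C (genIter d m).1 * Polynomial.X ^ N := by
    rw [← hs]
    exact map_dvd (scaleCoeff d) hp₁
  obtain ⟨r, j, hr⟩ := eq_C_mul_X_pow_of_dvd hne hdvd
  exact isUnit_of_isUnit_toDiagonal hr
    (isRelPrime_toDiagonal_genIter d m (map_dvd _ hp₁) (map_dvd _ hp₂))

theorem prime_pow_dvd_cross_genIter_gcd {d : ℕ} {p : MvPolynomial (Fin 2) (CoeffRing d)}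
    (hp : Prime p) (e m k : ℕ) :
    p ^ e ∣ X 1 * (genIter d (m.gcd k)).1 - X 0 * (genIter d (m.gcd k)).2 ↔
      p ^ e ∣ X 1 * (genIter d m).1 - X 0 * (genIter d m).2 ∧
      p ^ e ∣ X 1 * (genIter d k).1 - X 0 * (genIter d k).2 := by
  have hprim : ∀ k, ¬ (p ∣ (genIter d k).1 ∧ p ∣ (genIter d k).2) :=
    fun k h => hp.not_isUnit (isRelPrime_genIter d k h.1 h.2)
  refine gcd_iff_of_add
    (H := fun m => p ^ e ∣ X 1 * (genIter d m).1 - X 0 * (genIter d m).2) ?_ ?_ m k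
  · simp [genIter, mul_comm]
  · intro m k hm
    have hmk : p ^ e ∣ (genIter d (m + k)).1 * (genIter d k).2 -
        (genIter d (m + k)).2 * (genIter d k).1 := by
      have h := pow_dvd_cross_genIter_add (m := m) (n := 0) (p := p) (e := e)
        (hm.trans (dvd_of_eq (by simp only [genIter]; ring))) k
      rwa [zero_add] at h
    constructor
    · intro h
      have h' := pow_dvd_cross_trans hp (hprim (m + k)) (u := X 0) (v := X 1)
        ((dvd_neg.2 h).trans (dvd_of_eq (by ring))) hmk
      exact (dvd_neg.2 h').trans (dvd_of_eq (by ring))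
    · intro h
      have h' := pow_dvd_cross_trans hp (hprim k) hmk (w := X 0) (z := X 1)
        (h.trans (dvd_of_eq (by ring)))
      exact h'.trans (dvd_of_eq (by ring))

/-- for d ≥ 1 and n ≥ 1, in ℤ[a_0,…,a_d,b_0,…,b_d,X,Y], the product of
Y·F_m − X·G_m over divisors m of n with μ(n/m) = −1 divides the product over divisors
with μ(n/m) = 1; i.e. the n-th dynatomic polynomial Φ_n = ∏_{m ∣ n} (Y·F_m − X·G_m)^{μ(n/m)}
has integer (polynomial) coefficients. -/
theorem dynatomic_is_polynomial (d n : ℕ) (hd : 1 ≤ d) (hn : 1 ≤ n) :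
    (∏ m ∈ n.divisors.filter fun m => ArithmeticFunction.moebius (n / m) = -1,
        (X 1 * (genIter d m).1 - X 0 * (genIter d m).2)) ∣
    (∏ m ∈ n.divisors.filter fun m => ArithmeticFunction.moebius (n / m) = 1,
        (X 1 * (genIter d m).1 - X 0 * (genIter d m).2)) := by
  exact prod_moebius_dvd_prod_of_strong_divisibility (fun _ hm => cross_genIter_ne_zero d hm)
    (fun _ hp => prime_pow_dvd_cross_genIter_gcd hp) n
end
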